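/- Let q be an odd prime power with q ≡ 2 or 3 (mod 5), let c ∈ F_{q^6} satisfy c^2 + c = 1, and let U_c = {(x, x^q + x^{q^3} + c·x^{q^5}) : x ∈ F_{q^6}}. Let s be an integer with gcd(s, 3) = 1, let δ ∈ F_{q^6} with δ^{q^3+1} ∉ {0, 1}, and set U^{3}_{s,δ} = {(x, δ·x^{q^s} + x^{q^{s+3}}) : x ∈ F_{q^6}}; assume moreover that U^{3}_{s,δ} is maximum scattered, i.e. every one-dimensional F_{q^6}-subspace of F_{q^6} × F_{q^6} meets U^{3}_{s,δ} in at most q elements. Then for every field automorphism σ of F_{q^6} and every bijective additive map φ : F_{q^6} × F_{q^6} → F_{q^6} × F_{q^6} satisfying φ(λ·v) = σ(λ)·φ(v) for all λ ∈ F_{q^6} and all v, one has { F_{q^6}·φ(u) : u ∈ U_c, u ≠ 0 } ≠ { F_{q^6}·w : w ∈ U^{3}_{s,δ}, w ≠ 0 }. (The linear set L_c is not PΓL(2, q^6)-equivalent to any linear set L^{3,6}_{s,δ}.) -/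

import Mathlib

/-- The value at `x` of the `q`-polynomial `∑ i < 6, a i X ^ (q ^ i)`. -/
def qPolyEval {F : Type*} [Field F] (q : ℕ) (a : ℕ → F) (x : F) : F :=
  ∑ i ∈ Finset.range 6, a i * x ^ q ^ i

/-- Coefficients of the `q`-th power of a `q`-polynomial, reduced modulo `X ^ (q ^ 6) - X`. -/
def qPolyShift {F : Type*} [Field F] (q : ℕ) (a : ℕ → F) (i : ℕ) : F :=
  a ((i + 5) % 6) ^ q

/-- Coefficients of the composition of two `q`-polynomials, reduced modulo `X ^ (q ^ 6) - X`. -/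
def qPolyComp {F : Type*} [Field F] (q : ℕ) (a b : ℕ → F) (j : ℕ) : F :=
  ∑ i ∈ Finset.range 6, a i * ((qPolyShift q)^[i] b) j

section QPoly

variable {F : Type*} [Field F] {q : ℕ}

lemma qPolyEval_pow (hadd : ∀ x y : F, (x + y) ^ q = x ^ q + y ^ q)
    (h6 : ∀ x : F, x ^ q ^ 6 = x) (a : ℕ → F) (x : F) :
    qPolyEval q a x ^ q = qPolyEval q (qPolyShift q a) x := by
  have hx : (x ^ q ^ 5) ^ q = x := by rw [← pow_mul, ← pow_succ]; exact h6 x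
  simp only [qPolyEval, qPolyShift, Finset.sum_range_succ, Finset.sum_range_zero, zero_add, hadd,
    mul_pow, hx]
  norm_num
  ring

lemma qPolyEval_pow_pow (hadd : ∀ x y : F, (x + y) ^ q = x ^ q + y ^ q)
    (h6 : ∀ x : F, x ^ q ^ 6 = x) (a : ℕ → F) (x : F) (k : ℕ) :
    qPolyEval q a x ^ q ^ k = qPolyEval q ((qPolyShift q)^[k] a) x := by
  induction k with
  | zero => simp
  | succ k ih =>
    rw [pow_succ, pow_mul, ih, qPolyEval_pow hadd h6, Function.iterate_succ_apply']

lemma qPolyEval_comp (hadd : ∀ x y : F, (x + y) ^ q = x ^ q + y ^ q)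
    (h6 : ∀ x : F, x ^ q ^ 6 = x) (a b : ℕ → F) (x : F) :
    qPolyEval q a (qPolyEval q b x) = qPolyEval q (qPolyComp q a b) x := by
  conv_lhs => rw [qPolyEval]
  simp only [qPolyEval_pow_pow hadd h6]
  simp only [qPolyEval, qPolyComp, Finset.mul_sum, Finset.sum_mul]
  rw [Finset.sum_comm]
  simp only [mul_assoc]

lemma qPolyEval_add (hadd : ∀ x y : F, (x + y) ^ q = x ^ q + y ^ q) (a : ℕ → F) (x y : F) :
    qPolyEval q a (x + y) = qPolyEval q a x + qPolyEval q a y := by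
  have h : ∀ i : ℕ, (x + y) ^ q ^ i = x ^ q ^ i + y ^ q ^ i := by
    intro i
    induction i with
    | zero => simp
    | succ i ih => rw [pow_succ, pow_mul, ih, hadd, ← pow_mul, ← pow_mul]
  simp only [qPolyEval, h, mul_add, Finset.sum_add_distrib]

lemma qPolyEval_id (x : F) : qPolyEval q (fun i => if i = 0 then 1 else 0) x = x := by
  simp [qPolyEval]

lemma exists_qPolyEval_leftInverse [Finite F] (hadd : ∀ x y : F, (x + y) ^ q = x ^ q + y ^ q)
    (h6 : ∀ x : F, x ^ q ^ 6 = x) (a : ℕ → F) (ha : Function.Bijective (qPolyEval q a)) :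
    ∃ b : ℕ → F, ∀ x, qPolyEval q b (qPolyEval q a x) = x := by
  set A : Equiv.Perm F := Equiv.ofBijective _ ha with hA
  have hpow : ∀ n : ℕ, ∃ b : ℕ → F, ∀ x, (A ^ n) x = qPolyEval q b x := by
    intro n
    induction n with
    | zero => exact ⟨_, fun x => (qPolyEval_id x).symm⟩
    | succ n ih =>
      obtain ⟨b, hb⟩ := ih
      refine ⟨qPolyComp q b a, fun x => ?_⟩
      rw [pow_succ, Equiv.Perm.mul_apply, hb, ← qPolyEval_comp hadd h6]
      rfl
  obtain ⟨b, hb⟩ := hpow (orderOf A - 1)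
  refine ⟨b, fun x => ?_⟩
  rw [← hb]
  change (A ^ (orderOf A - 1)) (A x) = x
  rw [← Equiv.Perm.mul_apply, ← pow_succ, Nat.sub_add_cancel (orderOf_pos A), pow_orderOf_eq_one]
  rfl

end QPoly

section PowerSums

variable {F : Type*} [Field F] [Fintype F] [DecidableEq F] {q : ℕ}

lemma sum_units_pow_mul_inv_pow (hcard : Fintype.card F = q ^ 6) {m n : ℕ}
    (hm : m < n + (q ^ 6 - 1)) (hn : n < m + (q ^ 6 - 1)) :
    ∑ x : Fˣ, (x : F) ^ m * ((x : F) ^ n)⁻¹ = if m = n then -1 else 0 := by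
  have hpos : 1 ≤ q ^ 6 := by rw [← hcard]; exact Fintype.card_pos
  have key : ∀ x : Fˣ, (x : F) ^ m * ((x : F) ^ n)⁻¹ = (x : F) ^ (m + (q ^ 6 - 1) - n) := by
    intro x
    have hx : (x : F) ≠ 0 := x.ne_zero
    rw [← div_eq_mul_inv, div_eq_iff (pow_ne_zero _ hx), ← pow_add, Nat.sub_add_cancel hn.le,
      pow_add, ← hcard, FiniteField.pow_card_sub_one_eq_one _ hx, mul_one]
  have hsum := FiniteField.sum_pow_units F (m + (q ^ 6 - 1) - n)
  simp only [key]
  rw [hsum, hcard]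
  congr 1
  simp only [eq_iff_iff]
  constructor
  · rintro ⟨k, hk⟩
    have h1 : 0 < k := by
      rcases Nat.eq_zero_or_pos k with rfl | h
      · omega
      · exact h
    have h2 : k < 2 := by
      by_contra! h
      have := Nat.mul_le_mul_left (q ^ 6 - 1) h
      omega
    obtain rfl : k = 1 := by omega
    omega
  · rintro rfl
    exact ⟨1, by omega⟩

lemma pow_le_pow_five {q i : ℕ} (hq : 3 ≤ q) (hi : i < 6) : q ^ i ≤ q ^ 5 :=
  Nat.pow_le_pow_right (by omega) (by omega)

lemma three_mul_pow_five_le {q : ℕ} (hq : 3 ≤ q) : 3 * q ^ 5 ≤ q ^ 6 := by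
  rw [pow_succ q 5, mul_comm]
  exact Nat.mul_le_mul_left _ hq

lemma sum_units_qPolyEval (hcard : Fintype.card F = q ^ 6) (hq : 3 ≤ q) (a : ℕ → F) {k : ℕ}
    (hk : k < 6) :
    ∑ x : Fˣ, qPolyEval q a x * ((x : F) ^ q ^ k)⁻¹ = - a k := by
  simp only [qPolyEval, Finset.sum_mul, mul_assoc]
  rw [Finset.sum_comm]
  simp only [← Finset.mul_sum]
  rw [Finset.sum_eq_single k]
  · rw [sum_units_pow_mul_inv_pow hcard] <;> simp
    all_goals
      have := three_mul_pow_five_le hq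
      have : 0 < q ^ 5 := by positivity
      omega
  · intro i hi hik
    have hi := Finset.mem_range.1 hi
    have h1 := three_mul_pow_five_le hq
    have h2 : 0 < q ^ 5 := by positivity
    have h3 := pow_le_pow_five hq hi
    have h4 := pow_le_pow_five hq hk
    rw [sum_units_pow_mul_inv_pow hcard (by omega) (by omega),
      if_neg (fun h => hik (Nat.pow_right_injective (by omega) h)), mul_zero]
  · simp [hk]

lemma pow_add_pow_eq_iff {q i j k : ℕ} (hq : 3 ≤ q) (hk : 0 < k) :
    q ^ i + q ^ j = 1 + q ^ k ↔ (i = 0 ∧ j = k) ∨ (i = k ∧ j = 0) := by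
  have inj : Function.Injective (q ^ · : ℕ → ℕ) := Nat.pow_right_injective (by omega)
  constructor
  · intro h
    rcases Nat.eq_zero_or_pos i with rfl | hi
    · exact Or.inl ⟨rfl, inj (by simp only [pow_zero] at h ⊢; omega)⟩
    rcases Nat.eq_zero_or_pos j with rfl | hj
    · exact Or.inr ⟨inj (by simp only [pow_zero] at h ⊢; omega), rfl⟩
    exfalso
    have h1 : q ∣ q ^ i + q ^ j := dvd_add (dvd_pow_self q hi.ne') (dvd_pow_self q hj.ne')
    rw [h, Nat.dvd_add_left (dvd_pow_self q hk.ne'), Nat.dvd_one] at h1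
    omega
  · rintro (⟨rfl, rfl⟩ | ⟨rfl, rfl⟩)
    · simp
    · simp [add_comm]

lemma sum_units_qPolyEval_mul (hcard : Fintype.card F = q ^ 6) (hq : 3 ≤ q) (a b : ℕ → F) {k : ℕ}
    (hk0 : 0 < k) (hk : k < 6) :
    ∑ x : Fˣ, qPolyEval q a x * qPolyEval q b x * ((x : F) ^ (1 + q ^ k))⁻¹
      = - (a 0 * b k + a k * b 0) := by
  have h1 := three_mul_pow_five_le hq
  have h2 : 2 ≤ q ^ 5 := le_trans (by omega) (Nat.le_self_pow (by norm_num) q)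
  have key : ∀ x : Fˣ, qPolyEval q a x * qPolyEval q b x * ((x : F) ^ (1 + q ^ k))⁻¹ =
      ∑ i ∈ Finset.range 6, ∑ j ∈ Finset.range 6,
        a i * b j * ((x : F) ^ (q ^ i + q ^ j) * ((x : F) ^ (1 + q ^ k))⁻¹) := by
    intro x
    simp only [qPolyEval, Finset.sum_mul]
    refine Finset.sum_congr rfl fun i _ => ?_
    rw [Finset.mul_sum, Finset.sum_mul]
    refine Finset.sum_congr rfl fun j _ => ?_
    rw [pow_add (x : F) (q ^ i)]
    ring
  have key2 : ∀ i ∈ Finset.range 6, ∀ j ∈ Finset.range 6,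
      ∑ x : Fˣ, a i * b j * ((x : F) ^ (q ^ i + q ^ j) * ((x : F) ^ (1 + q ^ k))⁻¹) =
        if (i = 0 ∧ j = k) ∨ (i = k ∧ j = 0) then - (a i * b j) else 0 := by
    intro i hi j hj
    have hi := pow_le_pow_five hq (Finset.mem_range.1 hi)
    have hj := pow_le_pow_five hq (Finset.mem_range.1 hj)
    have hk := pow_le_pow_five hq hk
    have : 0 < q ^ i := by positivity
    have : 0 < q ^ j := by positivity
    rw [← Finset.mul_sum, sum_units_pow_mul_inv_pow hcard (by omega) (by omega)]
    simp only [pow_add_pow_eq_iff hq hk0, mul_ite, mul_neg, mul_one, mul_zero]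
  simp only [key]
  rw [Finset.sum_comm, Finset.sum_congr rfl fun i hi => by
    rw [Finset.sum_comm, Finset.sum_congr rfl (key2 i hi)]]
  interval_cases k <;> simp [Finset.sum_range_succ] <;> ring

lemma pow_add_pow_add_pow_eq_iff {q i j k : ℕ} (hq : 3 ≤ q) :
    q ^ i + q ^ j + q ^ k = 1 + q + q ^ 2 ↔
      (i = 0 ∧ j = 1 ∧ k = 2) ∨ (i = 0 ∧ j = 2 ∧ k = 1) ∨ (i = 1 ∧ j = 0 ∧ k = 2) ∨
      (i = 1 ∧ j = 2 ∧ k = 0) ∨ (i = 2 ∧ j = 0 ∧ k = 1) ∨ (i = 2 ∧ j = 1 ∧ k = 0) := by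
  constructor
  · intro h
    have small : ∀ n : ℕ, q ^ n ≤ 1 + q + q ^ 2 → n < 3 := by
      intro n hn
      by_contra! h3
      have : q ^ 3 ≤ q ^ n := Nat.pow_le_pow_right (by omega) h3
      nlinarith [sq_nonneg q]
    have hi := small i (by omega)
    have hj := small j (by omega)
    have hk := small k (by omega)
    interval_cases i <;> interval_cases j <;> interval_cases k <;> simp at h ⊢ <;> nlinarith
  · rintro (⟨rfl, rfl, rfl⟩ | ⟨rfl, rfl, rfl⟩ | ⟨rfl, rfl, rfl⟩ | ⟨rfl, rfl, rfl⟩ |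
      ⟨rfl, rfl, rfl⟩ | ⟨rfl, rfl, rfl⟩) <;> ring

lemma sum_units_qPolyEval_mul_mul (hcard : Fintype.card F = q ^ 6) (hq : 3 ≤ q) (a b c : ℕ → F) :
    ∑ x : Fˣ, qPolyEval q a x * qPolyEval q b x * qPolyEval q c x *
        ((x : F) ^ (1 + q + q ^ 2))⁻¹
      = - (a 0 * b 1 * c 2 + a 0 * b 2 * c 1 + a 1 * b 0 * c 2 + a 1 * b 2 * c 0 +
          a 2 * b 0 * c 1 + a 2 * b 1 * c 0) := by
  have h1 := three_mul_pow_five_le hq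
  have key : ∀ x : Fˣ, qPolyEval q a x * qPolyEval q b x * qPolyEval q c x *
        ((x : F) ^ (1 + q + q ^ 2))⁻¹ =
      ∑ i ∈ Finset.range 6, ∑ j ∈ Finset.range 6, ∑ k ∈ Finset.range 6,
        a i * b j * c k * ((x : F) ^ (q ^ i + q ^ j + q ^ k) *
          ((x : F) ^ (1 + q + q ^ 2))⁻¹) := by
    intro x
    simp only [qPolyEval, Finset.sum_mul]
    refine Finset.sum_congr rfl fun i _ => ?_
    rw [Finset.mul_sum _ (fun j => b j * (x : F) ^ q ^ j), Finset.sum_mul, Finset.sum_mul]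
    refine Finset.sum_congr rfl fun j _ => ?_
    rw [Finset.mul_sum, Finset.sum_mul]
    refine Finset.sum_congr rfl fun k _ => ?_
    rw [pow_add (x : F) (q ^ i + q ^ j), pow_add (x : F) (q ^ i)]
    ring
  have key2 : ∀ i ∈ Finset.range 6, ∀ j ∈ Finset.range 6, ∀ k ∈ Finset.range 6,
      ∑ x : Fˣ, a i * b j * c k * ((x : F) ^ (q ^ i + q ^ j + q ^ k) *
          ((x : F) ^ (1 + q + q ^ 2))⁻¹) =
        if (i = 0 ∧ j = 1 ∧ k = 2) ∨ (i = 0 ∧ j = 2 ∧ k = 1) ∨ (i = 1 ∧ j = 0 ∧ k = 2) ∨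
          (i = 1 ∧ j = 2 ∧ k = 0) ∨ (i = 2 ∧ j = 0 ∧ k = 1) ∨ (i = 2 ∧ j = 1 ∧ k = 0)
        then - (a i * b j * c k) else 0 := by
    intro i hi j hj k hk
    have hi := pow_le_pow_five hq (Finset.mem_range.1 hi)
    have hj := pow_le_pow_five hq (Finset.mem_range.1 hj)
    have hk := pow_le_pow_five hq (Finset.mem_range.1 hk)
    have : 0 < q ^ i := by positivity
    have : 0 < q ^ j := by positivity
    have : 0 < q ^ k := by positivity
    have : q ^ 2 ≤ q ^ 5 := pow_le_pow_five hq (by norm_num)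
    have : q ≤ q ^ 5 := Nat.le_self_pow (by norm_num) q
    rw [← Finset.mul_sum, sum_units_pow_mul_inv_pow hcard (by omega) (by omega)]
    simp only [pow_add_pow_add_pow_eq_iff hq, mul_ite, mul_neg, mul_one, mul_zero]
  simp only [key]
  rw [Finset.sum_comm, Finset.sum_congr rfl fun i hi => by
    rw [Finset.sum_comm, Finset.sum_congr rfl fun j hj => by
      rw [Finset.sum_comm, Finset.sum_congr rfl (key2 i hi j hj)]]]
  simp [Finset.sum_range_succ]
  ring

lemma qPoly_coeff_eq (hcard : Fintype.card F = q ^ 6) (hq : 3 ≤ q) {a b : ℕ → F}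
    (h : ∀ x, qPolyEval q a x = qPolyEval q b x) {k : ℕ} (hk : k < 6) : a k = b k := by
  have ha := sum_units_qPolyEval hcard hq a hk
  have hb := sum_units_qPolyEval hcard hq b hk
  simp only [h] at ha
  exact neg_injective (ha.symm.trans hb)

/-- For additive `f`, every value of `f x / x` is attained `-1` times modulo the characteristic. -/
lemma sum_units_comp_div (f : F → F) (hf : ∀ x y, f (x + y) = f x + f y) (h : F → F) :
    ∑ x : Fˣ, h (f x / x) = - ∑ t ∈ Finset.univ.image (fun x : Fˣ => f x / x), h t := by
  rw [Finset.sum_comp h (fun x : Fˣ => f x / x), ← Finset.sum_neg_distrib]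
  refine Finset.sum_congr rfl fun t ht => ?_
  obtain ⟨x₀, -, hx₀⟩ := Finset.mem_image.1 ht
  suffices hc : ((Finset.univ.filter (fun x : Fˣ => f x / x = t)).card : F) = -1 by
    rw [nsmul_eq_mul, hc, neg_one_mul]
  let g : F →+ F := AddMonoidHom.mk' f hf - AddMonoidHom.mulLeft t
  have hg : ∀ x, g x = 0 ↔ f x = t * x := fun x => sub_eq_zero
  have hmem : (x₀ : F) ∈ g.ker := by
    rw [AddMonoidHom.mem_ker, hg, ← hx₀, div_mul_cancel₀ _ x₀.ne_zero]
  have hker : ((Nat.card g.ker : ℕ) : F) = 0 := by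
    obtain ⟨p, hp⟩ := CharP.exists F
    have : Fact p.Prime := ⟨CharP.char_is_prime F p⟩
    rw [CharP.cast_eq_zero_iff F p]
    have hord : addOrderOf (⟨x₀, hmem⟩ : g.ker) = p := by
      apply addOrderOf_eq_prime
      · ext
        simp
      · intro h0
        exact x₀.ne_zero (congrArg Subtype.val h0)
    rw [← hord]
    exact addOrderOf_dvd_natCard _
  have hcard : Nat.card g.ker = (Finset.univ.filter (fun x : Fˣ => f x / x = t)).card + 1 := by
    have himage : (Finset.univ.filter (fun x : F => f x = t * x)) =
        insert 0 ((Finset.univ.filter (fun x : Fˣ => f x / x = t)).image (fun x : Fˣ => (x : F))) := by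
      ext x
      simp only [Finset.mem_filter, Finset.mem_univ, true_and, Finset.mem_insert, Finset.mem_image]
      constructor
      · intro hx
        by_cases h0 : x = 0
        · exact Or.inl h0
        · exact Or.inr ⟨Units.mk0 x h0, by simpa [div_eq_iff h0] using hx, rfl⟩
      · rintro (rfl | ⟨y, hy, rfl⟩)
        · exact (hg 0).1 (map_zero g)
        · exact (div_eq_iff y.ne_zero).1 hy
    rw [← Finset.card_image_of_injective _ Units.val_injective, ← Finset.card_insert_of_notMem,
      ← himage]
    · exact Nat.subtype_card _ fun x => by simp [AddMonoidHom.mem_ker, hg]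
    · simp
  rw [hcard] at hker
  push_cast at hker
  exact eq_neg_of_add_eq_zero_left hker

end PowerSums

/-- The coefficients of a binomial `α X ^ q + β X ^ (q ^ 4)` or `α X ^ (q ^ 2) + β X ^ (q ^ 5)`
with nonzero `α` and `β`. -/
def IsCubicBinomial {F : Type*} [Field F] (a : ℕ → F) : Prop :=
  a 0 = 0 ∧ a 3 = 0 ∧
    ((a 1 ≠ 0 ∧ a 4 ≠ 0 ∧ a 2 = 0 ∧ a 5 = 0) ∨ (a 2 ≠ 0 ∧ a 5 ≠ 0 ∧ a 1 = 0 ∧ a 4 = 0))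

/-- The coefficients of `u X + v (X ^ q + X ^ (q ^ 3) + c X ^ (q ^ 5))`. -/
def trinomialCoeff {F : Type*} [Field F] (c u v : F) (i : ℕ) : F :=
  if i = 0 then u else if i = 1 ∨ i = 3 then v else if i = 5 then v * c else 0

lemma qPolyEval_trinomialCoeff {F : Type*} [Field F] {q : ℕ} (c u v x : F) :
    qPolyEval q (trinomialCoeff c u v) x = x * u + (x ^ q + x ^ q ^ 3 + c * x ^ q ^ 5) * v := by
  simp [qPolyEval, trinomialCoeff, Finset.sum_range_succ]
  ring

section LinearSet

variable {F : Type*} [Field F] {q : ℕ}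

lemma IsCubicBinomial.of_range_eq [Fintype F] (hcard : Fintype.card F = q ^ 6) (hq : 3 ≤ q)
    (hadd : ∀ x y : F, (x + y) ^ q = x ^ q + y ^ q) {a b : ℕ → F} (hb : IsCubicBinomial b)
    (hab : Set.range (fun x : Fˣ => qPolyEval q a x / x) =
      Set.range (fun x : Fˣ => qPolyEval q b x / x)) :
    IsCubicBinomial a := by
  classical
  have h6 : ∀ x : F, x ^ q ^ 6 = x := fun x => by rw [← hcard]; exact FiniteField.pow_card x
  have hq0 : q ≠ 0 := by omega
  have himage : Finset.univ.image (fun x : Fˣ => qPolyEval q a x / (x : F)) =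
      Finset.univ.image (fun x : Fˣ => qPolyEval q b x / (x : F)) := by
    apply Finset.coe_injective
    simpa using hab
  have hsum : ∀ h : F → F, ∑ x : Fˣ, h (qPolyEval q a x / x) =
      ∑ x : Fˣ, h (qPolyEval q b x / x) := by
    intro h
    rw [sum_units_comp_div _ (qPolyEval_add hadd a), sum_units_comp_div _ (qPolyEval_add hadd b),
      himage]
  have hone : a 0 = b 0 := by
    have h := hsum id
    have e : ∀ (d : ℕ → F) (x : Fˣ), id (qPolyEval q d x / x) =
        qPolyEval q d x * ((x : F) ^ q ^ 0)⁻¹ := fun d x => by simp [div_eq_mul_inv]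
    simp only [e, sum_units_qPolyEval hcard hq _ (show 0 < 6 by norm_num)] at h
    exact neg_injective h
  have htwo : ∀ k, 0 < k → k < 6 →
      a 0 * (qPolyShift q)^[k] a k + a k * (qPolyShift q)^[k] a 0 =
        b 0 * (qPolyShift q)^[k] b k + b k * (qPolyShift q)^[k] b 0 := by
    intro k hk0 hk
    have h := hsum (· ^ (1 + q ^ k))
    have e : ∀ (d : ℕ → F) (x : Fˣ), (qPolyEval q d x / x) ^ (1 + q ^ k) =
        qPolyEval q d x * qPolyEval q ((qPolyShift q)^[k] d) x * ((x : F) ^ (1 + q ^ k))⁻¹ := by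
      intro d x
      rw [div_pow, div_eq_mul_inv, ← qPolyEval_pow_pow hadd h6]
      ring
    simp only [e, sum_units_qPolyEval_mul hcard hq _ _ hk0 hk] at h
    exact neg_injective h
  have hthree := hsum (· ^ (1 + q + q ^ 2))
  have e : ∀ (d : ℕ → F) (x : Fˣ), (qPolyEval q d x / x) ^ (1 + q + q ^ 2) =
      qPolyEval q d x * qPolyEval q (qPolyShift q d) x *
        qPolyEval q (qPolyShift q (qPolyShift q d)) x * ((x : F) ^ (1 + q + q ^ 2))⁻¹ := by
    intro d x
    rw [div_pow, div_eq_mul_inv, ← qPolyEval_pow hadd h6 (qPolyShift q d),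
      ← qPolyEval_pow hadd h6 d]
    ring
  simp only [e, sum_units_qPolyEval_mul_mul hcard hq] at hthree
  have hthree := neg_injective hthree
  obtain ⟨hb0, hb3, hb⟩ := hb
  have ha0 : a 0 = 0 := hone.trans hb0
  have h1 := htwo 1 (by norm_num) (by norm_num)
  have h2 := htwo 2 (by norm_num) (by norm_num)
  have h3 := htwo 3 (by norm_num) (by norm_num)
  simp [qPolyShift, hb0, hb3, ha0, hq0] at h1 h2 h3 hthree
  have h1' : a 1 = 0 ∨ a 5 = 0 := by
    rcases hb with ⟨_, _, h, h'⟩ | ⟨_, _, h, h'⟩ <;> simpa [h, h', hq0] using h1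
  have h2' : a 2 = 0 ∨ a 4 = 0 := by
    rcases hb with ⟨_, _, h, h'⟩ | ⟨_, _, h, h'⟩ <;> simpa [h, h', hq0] using h2
  refine ⟨ha0, by simpa using h3, ?_⟩
  have hne : a 1 * a 1 ^ q * (a 4 ^ q) ^ q + a 2 * a 5 ^ q * (a 5 ^ q) ^ q ≠ 0 := by
    rcases hb with ⟨hx, hy, hz, hw⟩ | ⟨hx, hy, hz, hw⟩ <;> simp [hz, hw, hq0] at hthree <;>
      rw [hthree] <;> simp [hx, hy]
  rcases h1' with h1' | h1' <;> rcases h2' with h2' | h2' <;> simp [h1', h2', hq0] at hne ⊢ <;>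
    tauto

lemma trinomialCoeff_eq_zero_of_qPolyComp {α : ℕ → F} (hq : q ≠ 0) (hα : IsCubicBinomial α)
    {c : F} (hc : c ≠ 0) {u v u' v' : F}
    (h : ∀ k < 6, qPolyComp q α (trinomialCoeff c u v) k = trinomialCoeff c u' v' k) :
    u = 0 ∧ v = 0 := by
  obtain ⟨h0, h3, hα⟩ := hα
  have e2 := h 2 (by norm_num)
  have e4 := h 4 (by norm_num)
  rcases hα with ⟨h1, h4, h2, h5⟩ | ⟨h2, h5, h1, h4⟩
  · simp [qPolyComp, qPolyShift, trinomialCoeff, Finset.sum_range_succ, *] at e2 e4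
    subst e2
    simpa [hq, h4] using e4
  · simp [qPolyComp, qPolyShift, trinomialCoeff, Finset.sum_range_succ, *] at e2 e4
    subst e4
    simpa [hq, h2] using e2

lemma pow_pow_mod_six (h6 : ∀ x : F, x ^ q ^ 6 = x) (x : F) (n : ℕ) :
    x ^ q ^ n = x ^ q ^ (n % 6) := by
  have h : ∀ m : ℕ, ∀ y : F, y ^ q ^ (6 * m) = y := by
    intro m
    induction m with
    | zero => simp
    | succ m ih => intro y; rw [mul_add, mul_one, pow_add, pow_mul, ih, h6]
  conv_lhs => rw [← Nat.div_add_mod n 6, pow_add, pow_mul, h]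

lemma exists_isCubicBinomial (h6 : ∀ x : F, x ^ q ^ 6 = x) {s : ℕ} (hs : Nat.gcd s 3 = 1) {δ : F}
    (hδ : δ ≠ 0) :
    ∃ b : ℕ → F, IsCubicBinomial b ∧
      ∀ x, qPolyEval q b x = δ * x ^ q ^ s + x ^ q ^ (s + 3) := by
  have hs3 : s % 3 ≠ 0 := by
    intro h
    have := Nat.gcd_eq_right (Nat.dvd_of_mod_eq_zero h)
    omega
  refine ⟨fun i => if i = s % 6 then δ else if i = (s + 3) % 6 then 1 else 0, ?_, fun x => ?_⟩
  · have h : s % 6 = 1 ∨ s % 6 = 2 ∨ s % 6 = 4 ∨ s % 6 = 5 := by omega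
    rw [Nat.add_mod]
    rcases h with h | h | h | h <;> simp [IsCubicBinomial, h, hδ]
  · rw [pow_pow_mod_six h6 x s, pow_pow_mod_six h6 x (s + 3)]
    have h : s % 6 = 1 ∨ s % 6 = 2 ∨ s % 6 = 4 ∨ s % 6 = 5 := by omega
    rw [Nat.add_mod]
    rcases h with h | h | h | h <;> simp [qPolyEval, Finset.sum_range_succ, h, add_comm]

/-- The set of points `⟨(A x, B x)⟩` with `A = u X + v T`, `B = u' X + v' T` for a trinomial `T`
is never the linear set of a cubic binomial, provided that `A` has no nonzero roots. -/
lemma range_trinomial_ne_range_cubicBinomial [Fintype F] (hcard : Fintype.card F = q ^ 6)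
    (hq : 3 ≤ q) (hadd : ∀ x y : F, (x + y) ^ q = x ^ q + y ^ q) {b : ℕ → F}
    (hb : IsCubicBinomial b) {c : F} (hc : c ≠ 0) (u v u' v' : F)
    (hA : ∀ x, x ≠ 0 → qPolyEval q (trinomialCoeff c u v) x ≠ 0) :
    Set.range (fun x : Fˣ => qPolyEval q (trinomialCoeff c u' v') x /
        qPolyEval q (trinomialCoeff c u v) x) ≠
      Set.range (fun x : Fˣ => qPolyEval q b x / x) := by
  classical
  intro heq
  have h6 : ∀ x : F, x ^ q ^ 6 = x := fun x => by rw [← hcard]; exact FiniteField.pow_card x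
  set A := qPolyEval q (trinomialCoeff c u v) with hAdef
  have hinj : Function.Injective A := by
    let g : F →+ F := AddMonoidHom.mk' A (qPolyEval_add hadd _)
    exact (injective_iff_map_eq_zero g).2 fun x hx => by
      by_contra h
      exact hA x h hx
  have hA0 : A 0 = 0 := map_zero (AddMonoidHom.mk' A (qPolyEval_add hadd _))
  have hbij : Function.Bijective A := Finite.injective_iff_bijective.1 hinj
  obtain ⟨r, hr⟩ := exists_qPolyEval_leftInverse hadd h6 _ hbij
  set α := qPolyComp q (trinomialCoeff c u' v') r with hα
  have hαA : ∀ x, qPolyEval q α (A x) = qPolyEval q (trinomialCoeff c u' v') x := by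
    intro x
    rw [hα, ← qPolyEval_comp hadd h6, hr]
  have hbin : IsCubicBinomial α := by
    refine IsCubicBinomial.of_range_eq hcard hq hadd hb (Eq.trans ?_ heq)
    ext t
    constructor
    · rintro ⟨y, rfl⟩
      obtain ⟨x, hx⟩ := hbij.2 y
      have hx0 : x ≠ 0 := by
        rintro rfl
        exact y.ne_zero (hx.symm.trans hA0)
      exact ⟨Units.mk0 x hx0, by simp only [Units.val_mk0, ← hx, hαA]⟩
    · rintro ⟨x, rfl⟩
      exact ⟨Units.mk0 (A x) (hA x x.ne_zero), by simp only [Units.val_mk0, hαA]⟩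
  obtain ⟨rfl, rfl⟩ := trinomialCoeff_eq_zero_of_qPolyComp (q := q) (by omega) hbin hc
    fun k hk => qPoly_coeff_eq hcard hq
      (fun x => (qPolyEval_comp hadd h6 α _ x).symm.trans (hαA x)) hk
  exact hA 1 one_ne_zero (by rw [hAdef, qPolyEval_trinomialCoeff]; simp)

end LinearSet

lemma add_pow_of_card_eq_pow {F : Type*} [Field F] [Fintype F] {q n : ℕ} (hq : IsPrimePow q)
    (hcard : Fintype.card F = q ^ n) (x y : F) : (x + y) ^ q = x ^ q + y ^ q := by
  obtain ⟨p, k, hp, hk, rfl⟩ := hq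
  have := Fact.mk hp.nat_prime
  have : CharP F p := by
    obtain ⟨p', hp'⟩ := CharP.exists F
    have hprime := CharP.char_is_prime F p'
    obtain ⟨m, -, hm⟩ := FiniteField.card F p'
    have hdvd : p' ∣ (p ^ k) ^ n := by
      rw [← hcard, hm]
      exact dvd_pow_self _ m.ne_zero
    rw [← (Nat.prime_dvd_prime_iff_eq hprime hp.nat_prime).1
      (hprime.dvd_of_dvd_pow (hprime.dvd_of_dvd_pow hdvd))]
    exact hp'
  exact add_pow_char_pow x y p k

lemma div_eq_div_of_span_singleton_eq {F : Type*} [Field F] {v w : F × F} (hv : v ≠ 0)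
    (hw : w.1 ≠ 0) (h : Submodule.span F {v} = Submodule.span F {w}) :
    v.1 ≠ 0 ∧ v.2 / v.1 = w.2 / w.1 := by
  obtain ⟨l, rfl⟩ := Submodule.mem_span_singleton.1 (h ▸ Submodule.mem_span_singleton_self v)
  have hl : l ≠ 0 := by
    rintro rfl
    simp at hv
  exact ⟨mul_ne_zero hl hw, mul_div_mul_left _ _ hl⟩


theorem stmt17 (q : ℕ) (hq : IsPrimePow q) (hodd : Odd q)
    (hq5 : q % 5 = 2 ∨ q % 5 = 3)
    (F : Type*) [Field F] [Fintype F] (hcard : Fintype.card F = q ^ 6)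
    (c : F) (hc : c ^ 2 + c = 1)
    (Uc : Set (F × F))
    (hUc : Uc = {p : F × F | ∃ x : F, p = (x, x ^ q + x ^ (q ^ 3) + c * x ^ (q ^ 5))})
    (s : ℕ) (hsgcd : Nat.gcd s 3 = 1)
    (δ : F) (hδ0 : δ ^ (q ^ 3 + 1) ≠ 0) (hδ1 : δ ^ (q ^ 3 + 1) ≠ 1)
    (U3 : Set (F × F))
    (hU3 : U3 = {p : F × F | ∃ x : F, p = (x, δ * x ^ (q ^ s) + x ^ (q ^ (s + 3)))})
    (hscatt : ∀ w : F × F, w ≠ 0 →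
        ({p ∈ U3 | ∃ l : F, p = l • w} : Set (F × F)).ncard ≤ q) :
    ∀ (σ : F ≃+* F) (φ : F × F → F × F),
      Function.Bijective φ →
      (∀ v w : F × F, φ (v + w) = φ v + φ w) →
      (∀ (l : F) (v : F × F), φ (l • v) = σ l • φ v) →
      ({W : Submodule F (F × F) | ∃ u ∈ Uc, u ≠ 0 ∧ W = Submodule.span F {φ u}} :
          Set (Submodule F (F × F)))
        ≠ {W : Submodule F (F × F) | ∃ w ∈ U3, w ≠ 0 ∧ W = Submodule.span F {w}} := by
  intro σ φ hφ hφadd hφsmul heq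
  have hq3 : 3 ≤ q := by
    have := hq.two_le
    obtain ⟨m, rfl⟩ := hodd
    omega
  have hadd := add_pow_of_card_eq_pow hq hcard
  have h6 : ∀ x : F, x ^ q ^ 6 = x := fun x => by rw [← hcard]; exact FiniteField.pow_card x
  have hδ : δ ≠ 0 := fun h => hδ0 (by simp [h])
  obtain ⟨b, hb, hbeval⟩ := exists_isCubicBinomial h6 hsgcd hδ
  have hc0 : c ≠ 0 := by
    rintro rfl
    simp at hc
  have hφ0 : φ 0 = 0 := by simpa using hφadd 0 0
  have hφne : ∀ u, u ≠ 0 → φ u ≠ 0 := fun u hu h => hu (hφ.1 (h.trans hφ0.symm))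
  set P := φ (1, 0) with hP
  set R := φ (0, 1) with hR
  have hφeval : ∀ y : F, φ (σ.symm y, σ.symm y ^ q + σ.symm y ^ q ^ 3 + c * σ.symm y ^ q ^ 5) =
      (qPolyEval q (trinomialCoeff (σ c) P.1 R.1) y,
        qPolyEval q (trinomialCoeff (σ c) P.2 R.2) y) := by
    intro y
    have hsplit : ∀ x z : F, φ (x, z) = σ x • P + σ z • R := by
      intro x z
      rw [hP, hR, ← hφsmul, ← hφsmul, ← hφadd]
      simp
    rw [hsplit]
    ext <;> simp [qPolyEval_trinomialCoeff]
  have hU3mem : ∀ w ∈ U3, w ≠ 0 → ∃ x : F, x ≠ 0 ∧ w = (x, qPolyEval q b x) := by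
    rw [hU3]
    rintro w ⟨x, rfl⟩ hw
    refine ⟨x, ?_, by rw [hbeval]⟩
    rintro rfl
    apply hw
    simp [show q ≠ 0 by omega]
  have hUcmem : ∀ u ∈ Uc, u ≠ 0 → ∃ y : F, y ≠ 0 ∧
      φ u = (qPolyEval q (trinomialCoeff (σ c) P.1 R.1) y,
        qPolyEval q (trinomialCoeff (σ c) P.2 R.2) y) := by
    rw [hUc]
    rintro u ⟨x, rfl⟩ hu
    refine ⟨σ x, ?_, by simpa using hφeval (σ x)⟩
    intro hx
    obtain rfl : x = 0 := by simpa using hx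
    apply hu
    simp [show q ≠ 0 by omega]
  have hpoint : ∀ y : F, y ≠ 0 → qPolyEval q (trinomialCoeff (σ c) P.1 R.1) y ≠ 0 ∧
      ∃ x : F, x ≠ 0 ∧ qPolyEval q (trinomialCoeff (σ c) P.2 R.2) y /
        qPolyEval q (trinomialCoeff (σ c) P.1 R.1) y = qPolyEval q b x / x := by
    intro y hy
    have hu0 : (σ.symm y, σ.symm y ^ q + σ.symm y ^ q ^ 3 + c * σ.symm y ^ q ^ 5) ≠ 0 :=
      fun h => hy (by simpa using congrArg Prod.fst h)
    obtain ⟨w, hw, hw0, hspan⟩ := heq.subset ⟨_, by rw [hUc]; exact ⟨_, rfl⟩, hu0, rfl⟩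
    obtain ⟨x, hx, rfl⟩ := hU3mem w hw hw0
    have hv0 := hφne _ hu0
    rw [hφeval] at hspan hv0
    have h := div_eq_div_of_span_singleton_eq hv0 hx hspan
    exact ⟨h.1, x, hx, h.2⟩
  refine range_trinomial_ne_range_cubicBinomial hcard hq3 hadd hb
    ((map_ne_zero σ).2 hc0) P.1 R.1 P.2 R.2 (fun y hy => (hpoint y hy).1) ?_
  ext t
  constructor
  · rintro ⟨y, rfl⟩
    obtain ⟨-, x, hx, h⟩ := hpoint y y.ne_zero
    exact ⟨Units.mk0 x hx, h.symm⟩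
  · rintro ⟨x, rfl⟩
    have hw0 : ((x : F), qPolyEval q b x) ≠ 0 := fun h => x.ne_zero (congrArg Prod.fst h)
    obtain ⟨u, hu, hu0, hspan⟩ := heq.superset ⟨((x : F), qPolyEval q b x),
      by rw [hU3]; exact ⟨x, by rw [hbeval]⟩, hw0, rfl⟩
    obtain ⟨y, hy, hφu⟩ := hUcmem u hu hu0
    have hv0 := hφne _ hu0
    rw [hφu] at hspan hv0
    exact ⟨Units.mk0 y hy, (div_eq_div_of_span_singleton_eq hv0 x.ne_zero hspan.symm).2⟩
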